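/- Let γ : S¹ → ℝ³ be a C^∞ injective map from the unit circle S¹ ⊂ ℝ² (with its standard smooth manifold structure) into ℝ³ whose differential is injective at every point, and let σ = γ(S¹), equipped with the metric restricted from the Euclidean metric of ℝ³. Then for every L > 1 there exist δ > 0 and a bijection e from σ × B̄²(δ) (where B̄²(δ) is the closed ball of radius δ centered at 0 in ℝ²) onto the closed δ-neighborhood B(σ,δ) = {x ∈ ℝ³ : dist(x,σ) ≤ δ} such that e(x,0) = x for every x ∈ σ, and e is L-bilipschitz with respect to the ℓ²-product metric on σ × B̄²(δ): for all p,q ∈ σ and u,v ∈ B̄²(δ), L⁻¹·(|p−q|² + |u−v|²)^{1/2} ≤ |e(p,u) − e(q,v)| ≤ L·(|p−q|² + |u−v|²)^{1/2}. -/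

import Mathlib

open Metric Manifold
noncomputable section

abbrev E3 := EuclideanSpace ℝ (Fin 3)
abbrev E2 := EuclideanSpace ℝ (Fin 2)

lemma periodic_lip (f : ℝ → E3) (hf : ContDiff ℝ 1 f) (hp : Function.Periodic f (2 * Real.pi)) :
    ∃ K : ℝ, 0 ≤ K ∧ ∀ s t, ‖f s - f t‖ ≤ K * |s - t| := by
  have hc : Continuous (deriv f) := hf.continuous_deriv le_rfl
  have hp' : Function.Periodic (deriv f) (2 * Real.pi) := by
    intro t
    rw [← deriv_comp_add_const]
    congr 1
    funext x
    exact hp x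
  have hb := hp'.isBounded_of_continuous Real.two_pi_pos.ne' hc
  obtain ⟨K, hK⟩ := hb.exists_norm_le
  have hK' : ∀ t, ‖deriv f t‖ ≤ K := fun t => hK _ ⟨t, rfl⟩
  refine ⟨K, (norm_nonneg _).trans (hK' 0), fun s t => ?_⟩
  have := Convex.norm_image_sub_le_of_norm_deriv_le (f := f) (s := Set.univ) (C := K)
    (fun x _ => (hf.differentiable one_ne_zero) x) (fun x _ => hK' x) convex_univ
    (Set.mem_univ t) (Set.mem_univ s)
  simpa using this

lemma taylor_bd (c c' : ℝ → E3) (hc : ∀ t, HasDerivAt c (c' t) t) (K : ℝ)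
    (hK0 : 0 ≤ K) (hK : ∀ s t, ‖c' s - c' t‖ ≤ K * |s - t|) (s t : ℝ) :
    ‖c s - c t - (s - t) • c' t‖ ≤ K * |s - t| ^ 2 := by
  have h := Convex.norm_image_sub_le_of_norm_hasDerivWithin_le
    (f := fun x => c x - (x - t) • c' t) (f' := fun x => c' x - (1:ℝ) • c' t)
    (s := Set.uIcc t s) (C := K * |s - t|) (x := t) (y := s)
    (fun x _ => ((hc x).sub (((hasDerivAt_id x).sub_const t).smul_const (c' t))).hasDerivWithinAt)
    (fun x hx => by
      simp only [one_smul]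
      refine (hK x t).trans ?_
      refine mul_le_mul_of_nonneg_left ?_ hK0
      exact Set.abs_sub_left_of_mem_uIcc hx)
    (convex_uIcc t s) Set.left_mem_uIcc Set.right_mem_uIcc
  simp only [sub_self, zero_smul, sub_zero, Real.norm_eq_abs] at h
  calc _ = ‖c s - (s - t) • c' t - c t‖ := by congr 1; abel
    _ ≤ _ := h
    _ = _ := by ring

lemma lower_bd (c c' : ℝ → E3) (hc : ∀ t, HasDerivAt c (c' t) t) (hc'c : Continuous c')
    (hp : Function.Periodic c (2 * Real.pi)) (hp' : Function.Periodic c' (2 * Real.pi))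
    (hne : ∀ t, c' t ≠ 0) (hinj : ∀ t h, |h| ≤ Real.pi → c (t + h) = c t → h = 0)
    (K : ℝ) (hK0 : 0 ≤ K) (hK : ∀ s t, ‖c' s - c' t‖ ≤ K * |s - t|) :
    ∃ k : ℝ, 0 < k ∧ ∀ s t, |s - t| ≤ Real.pi → k * |s - t| ≤ ‖c s - c t‖ := by
  have hcc : Continuous c := continuous_iff_continuousAt.2 fun t => (hc t).continuousAt
  obtain ⟨m, hm, hm'⟩ : ∃ m : ℝ, 0 < m ∧ ∀ t, m ≤ ‖c' t‖ := by
    obtain ⟨x, -, hx⟩ := (isCompact_Icc (a := (0:ℝ)) (b := 2 * Real.pi)).exists_isMinOn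
      ⟨0, by simp [Real.pi_pos.le]⟩ (hc'c.norm.continuousOn)
    refine ⟨‖c' x‖, norm_pos_iff.2 (hne x), fun t => ?_⟩
    obtain ⟨y, hy, hy'⟩ := hp'.exists_mem_Ico₀ Real.two_pi_pos t
    rw [hy']
    exact hx ⟨hy.1, hy.2.le⟩
  set r : ℝ := m / (2 * (K + 1)) with hr
  have hr0 : 0 < r := by positivity
  have hrK : K * r ≤ m / 2 := by
    rw [hr, mul_div_assoc', div_le_div_iff₀ (by positivity) (by positivity)]
    nlinarith
  -- far part
  obtain ⟨n, hn, hn'⟩ : ∃ n : ℝ, 0 < n ∧ ∀ t h, r ≤ |h| → |h| ≤ Real.pi → n ≤ ‖c (t + h) - c t‖ := by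
    let S : Set (ℝ × ℝ) := Set.Icc 0 (2 * Real.pi) ×ˢ (Set.Icc (-Real.pi) Real.pi ∩ {h | r ≤ |h|})
    have hS : IsCompact S := isCompact_Icc.prod
      (isCompact_Icc.inter_right (isClosed_le continuous_const continuous_abs))
    by_cases hSe : S.Nonempty
    · obtain ⟨x, hxS, hx⟩ := hS.exists_isMinOn hSe
        (f := fun x : ℝ × ℝ => ‖c (x.1 + x.2) - c x.1‖) (by fun_prop)
      refine ⟨_, (norm_pos_iff (a := c (x.1 + x.2) - c x.1)).2 ?_, ?_⟩
      · intro h0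
        have h1 := hinj x.1 x.2 (abs_le.2 hxS.2.1) (sub_eq_zero.1 h0)
        have h2 : r ≤ |x.2| := hxS.2.2
        rw [h1] at h2
        simp at h2; linarith
      · intro t h h1 h2
        obtain ⟨j, hj, -⟩ := existsUnique_add_zsmul_mem_Ico Real.two_pi_pos t 0
        have e1 : c (t + h) = c (t + j • (2 * Real.pi) + h) := by
          rw [show t + j • (2 * Real.pi) + h = t + h + j • (2 * Real.pi) by ring]
          exact (hp.zsmul j _).symm
        have e2 : c t = c (t + j • (2 * Real.pi)) := (hp.zsmul j _).symm
        rw [e1, e2]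
        have hj2 : t + j • (2 * Real.pi) ≤ 2 * Real.pi := by simpa using hj.2.le
        have hj1 := hj.1
        clear e1 e2 hj
        generalize t + j • (2 * Real.pi) = y at *
        exact isMinOn_iff.1 hx (y, h) ⟨⟨hj1, hj2⟩, abs_le.1 h2, h1⟩
    · refine ⟨1, one_pos, fun t h h1 h2 => ?_⟩
      exact (hSe ⟨(0, h), ⟨⟨le_rfl, Real.two_pi_pos.le⟩, abs_le.1 h2, h1⟩⟩).elim
  refine ⟨min (m / 2) (n / Real.pi), lt_min (by positivity) (div_pos hn Real.pi_pos), fun s t hst => ?_⟩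
  rcases le_or_gt r |s - t| with h | h
  · have := hn' t (s - t) h hst
    rw [add_sub_cancel] at this
    calc _ ≤ n / Real.pi * Real.pi := by
          gcongr
          exact min_le_right _ _
      _ = n := by field_simp
      _ ≤ _ := this
  · have h1 := taylor_bd c c' hc K hK0 hK s t
    have h2 : ‖(s - t) • c' t‖ ≤ ‖c s - c t‖ + ‖c s - c t - (s - t) • c' t‖ := by
      have := norm_sub_le (c s - c t) (c s - c t - (s - t) • c' t)
      simpa using this
    rw [norm_smul, Real.norm_eq_abs] at h2
    have h3 := mul_le_mul_of_nonneg_left (hm' t) (abs_nonneg (s - t))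
    have h4 : K * |s - t| ^ 2 ≤ m / 2 * |s - t| := by
      have : K * |s - t| ≤ m / 2 := (mul_le_mul_of_nonneg_left h.le hK0).trans hrK
      nlinarith [abs_nonneg (s - t)]
    have h5 : min (m / 2) (n / Real.pi) * |s - t| ≤ m / 2 * |s - t| := by
      gcongr; exact min_le_left _ _
    linarith

/-- cross product -/
def cr (x y : E3) : E3 := !₂[x 1 * y 2 - x 2 * y 1, x 2 * y 0 - x 0 * y 2, x 0 * y 1 - x 1 * y 0]

lemma inner3 (x y : E3) : inner ℝ x y = x 0 * y 0 + x 1 * y 1 + x 2 * y 2 := by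
  simp [PiLp.inner_apply, Fin.sum_univ_three]; ring

lemma cr_left (x y : E3) : inner ℝ x (cr x y) = 0 := by
  simp [inner3, cr]; ring
lemma cr_right (x y : E3) : inner ℝ y (cr x y) = 0 := by
  simp [inner3, cr]; ring

lemma cr_contDiff (f g : ℝ → E3) (hf : ContDiff ℝ 1 f) (hg : ContDiff ℝ 1 g) :
    ContDiff ℝ 1 (fun t => cr (f t) (g t)) := by
  rw [contDiff_euclidean] at *
  intro i
  have h0 := hf 0; have h1 := hf 1; have h2 := hf 2
  have g0 := hg 0; have g1 := hg 1; have g2 := hg 2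
  fin_cases i <;> simp [cr] <;> fun_prop

lemma cr_ne (x y : E3) (hx : x ≠ 0) (h : ∀ l : ℝ, l • x ≠ y) : cr x y ≠ 0 := by
  intro h0
  have hx2 : inner ℝ x x ≠ (0:ℝ) := inner_self_ne_zero.2 hx
  apply h (inner ℝ x y / inner ℝ x x)
  have a0 : (cr x y) 0 = 0 := by rw [h0]; rfl
  have a1 : (cr x y) 1 = 0 := by rw [h0]; rfl
  have a2 : (cr x y) 2 = 0 := by rw [h0]; rfl
  simp [cr] at a0 a1 a2
  rw [inner3] at hx2
  ext i
  simp only [inner3, PiLp.smul_apply, smul_eq_mul]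
  rw [div_mul_eq_mul_div, div_eq_iff hx2]
  fin_cases i <;> simp
  · linear_combination x 1 * a2 - x 2 * a1
  · linear_combination x 2 * a0 - x 0 * a2
  · linear_combination x 0 * a1 - x 1 * a0

lemma frame (c' : ℝ → E3) (hc' : ContDiff ℝ 1 c')
    (hp' : Function.Periodic c' (2 * Real.pi)) (hne : ∀ t, c' t ≠ 0) :
    ∃ N M : ℝ → E3, ContDiff ℝ 1 N ∧ ContDiff ℝ 1 M ∧ Function.Periodic N (2 * Real.pi) ∧
      Function.Periodic M (2 * Real.pi) ∧ (∀ t, ‖N t‖ = 1) ∧ (∀ t, ‖M t‖ = 1) ∧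
      (∀ t, inner ℝ (N t) (M t) = (0:ℝ)) ∧ (∀ t, inner ℝ (c' t) (N t) = (0:ℝ)) ∧
      (∀ t, inner ℝ (c' t) (M t) = (0:ℝ)) ∧
      (∀ t x, inner ℝ (c' t) x = (0:ℝ) → ∃ a b : ℝ, x = a • N t + b • M t) := by
  obtain ⟨a, ha⟩ : ∃ a : E3, a ∉ Set.range (fun p : ℝ × ℝ => p.1 • c' p.2) := by
    have h : ContDiff ℝ 1 (fun p : ℝ × ℝ => p.1 • c' p.2) := by fun_prop
    exact (h.dense_compl_range_of_finrank_lt_finrank (by simp)).nonempty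
  have ha' : ∀ t (l : ℝ), l • c' t ≠ a := fun t l h => ha ⟨(l, t), h⟩
  set A : ℝ → E3 := fun t => cr (c' t) a with hA
  set B : ℝ → E3 := fun t => cr (c' t) (A t) with hB
  have hAne : ∀ t, A t ≠ 0 := fun t => cr_ne _ _ (hne t) (ha' t)
  have hcA : ∀ t, inner ℝ (c' t) (A t) = (0:ℝ) := fun t => cr_left _ _
  have hBne : ∀ t, B t ≠ 0 := fun t => cr_ne _ _ (hne t) (fun l hl => by
    have := hcA t
    rw [← hl, inner_smul_right] at this
    rcases mul_eq_zero.1 this with h | h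
    · apply hAne t; rw [← hl, h, zero_smul]
    · exact hne t (inner_self_eq_zero.1 h))
  have hcB : ∀ t, inner ℝ (c' t) (B t) = (0:ℝ) := fun t => cr_left _ _
  have hAB : ∀ t, inner ℝ (A t) (B t) = (0:ℝ) := fun t => cr_right _ _
  have hAs : ContDiff ℝ 1 A := cr_contDiff _ _ hc' contDiff_const
  have hBs : ContDiff ℝ 1 B := cr_contDiff _ _ hc' hAs
  have hAp : Function.Periodic A (2 * Real.pi) := fun t => by simp only [hA, hp' t]
  have hBp : Function.Periodic B (2 * Real.pi) := fun t => by simp only [hB, hp' t, hAp t]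
  refine ⟨fun t => ‖A t‖⁻¹ • A t, fun t => ‖B t‖⁻¹ • B t, ?_, ?_, ?_, ?_, ?_, ?_, ?_, ?_, ?_, ?_⟩
  · exact ((hAs.norm ℝ hAne).inv fun t => norm_ne_zero_iff.2 (hAne t)).smul hAs
  · exact ((hBs.norm ℝ hBne).inv fun t => norm_ne_zero_iff.2 (hBne t)).smul hBs
  · intro t; simp only [hAp t]
  · intro t; simp only [hBp t]
  · intro t; exact norm_smul_inv_norm (𝕜 := ℝ) (hAne t)
  · intro t; exact norm_smul_inv_norm (𝕜 := ℝ) (hBne t)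
  · intro t; simp [inner_smul_left, inner_smul_right, hAB]
  · intro t; simp [inner_smul_right, hcA]
  · intro t; simp [inner_smul_right, hcB]
  · intro t x hx
    have hv : Orthonormal ℝ ![‖c' t‖⁻¹ • c' t, ‖A t‖⁻¹ • A t, ‖B t‖⁻¹ • B t] := by
      constructor
      · intro i
        fin_cases i
        · exact norm_smul_inv_norm (𝕜 := ℝ) (hne t)
        · exact norm_smul_inv_norm (𝕜 := ℝ) (hAne t)
        · exact norm_smul_inv_norm (𝕜 := ℝ) (hBne t)
      · intro i j hij
        have h1 := hcA t; have h2 := hcB t; have h3 := hAB t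
        have h1' := h1; have h2' := h2; have h3' := h3
        rw [real_inner_comm] at h1' h2' h3'
        fin_cases i <;> fin_cases j <;>
          simp [inner_smul_left, inner_smul_right, h1, h2, h3, h1', h2', h3'] at hij ⊢
    let b := OrthonormalBasis.mk hv (by
      have := (basisOfOrthonormalOfCardEqFinrank hv (by simp)).span_eq
      rw [coe_basisOfOrthonormalOfCardEqFinrank] at this
      exact this.ge)
    have := b.sum_repr' x
    rw [Fin.sum_univ_three] at this
    simp only [b, OrthonormalBasis.coe_mk] at this
    refine ⟨inner ℝ (‖A t‖⁻¹ • A t) x, inner ℝ (‖B t‖⁻¹ • B t) x, Eq.trans this.symm ?_⟩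
    simp [inner_smul_left, hx]

lemma key_est (X Y Z : E3) (η : ℝ) (h0 : 0 ≤ η) (h1 : 2 * η ≤ 1)
    (hXY : |inner ℝ X Y| ≤ η * ‖X‖ ^ 2) (hZ : ‖Z‖ ≤ η * ‖X‖) :
    (1 - 3 * η) * Real.sqrt (‖X‖ ^ 2 + ‖Y‖ ^ 2) ≤ ‖X + Y + Z‖ ∧
    ‖X + Y + Z‖ ≤ (1 + 3 * η) * Real.sqrt (‖X‖ ^ 2 + ‖Y‖ ^ 2) := by
  set D := Real.sqrt (‖X‖ ^ 2 + ‖Y‖ ^ 2) with hD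
  have hD0 : 0 ≤ D := Real.sqrt_nonneg _
  have hD2 : D ^ 2 = ‖X‖ ^ 2 + ‖Y‖ ^ 2 := Real.sq_sqrt (by positivity)
  have hXD : ‖X‖ ≤ D := Real.le_sqrt_of_sq_le (by nlinarith [sq_nonneg ‖Y‖])
  have hZ' : ‖Z‖ ≤ η * D := hZ.trans (by gcongr)
  have hn := norm_add_sq_real X Y
  have hXY' : |inner ℝ X Y| ≤ η * D ^ 2 := hXY.trans (by gcongr)
  obtain ⟨i1, i2⟩ := abs_le.1 hXY'
  have up : ‖X + Y‖ ≤ (1 + 2 * η) * D := by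
    refine le_of_sq_le_sq ?_ (by positivity)
    nlinarith [mul_nonneg h0 (sq_nonneg D), mul_nonneg (mul_nonneg h0 h0) (sq_nonneg D)]
  have lo : (1 - 2 * η) * D ≤ ‖X + Y‖ := by
    refine le_of_sq_le_sq ?_ (by positivity)
    nlinarith [mul_nonneg (mul_nonneg h0 (sub_nonneg.2 h1)) (sq_nonneg D)]
  have t1 := norm_add_le (X + Y) Z
  have t2 : ‖X + Y‖ ≤ ‖X + Y + Z‖ + ‖Z‖ := by
    have := norm_sub_le (X + Y + Z) Z
    simpa using this
  constructor <;> nlinarith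

lemma norm_comb (N M : E3) (hN : ‖N‖ = 1) (hM : ‖M‖ = 1) (hNM : inner ℝ N M = (0:ℝ)) (u : E2) :
    ‖u 0 • N + u 1 • M‖ = ‖u‖ := by
  rw [← sq_eq_sq₀ (norm_nonneg _) (norm_nonneg _), norm_add_sq_real,
    EuclideanSpace.norm_sq_eq u, norm_smul, norm_smul, hN, hM, inner_smul_left, inner_smul_right,
    hNM]
  simp

lemma core (c c' : ℝ → E3) (hc : ∀ t, HasDerivAt c (c' t) t) (hc' : ContDiff ℝ 1 c')
    (hp : Function.Periodic c (2 * Real.pi)) (hp' : Function.Periodic c' (2 * Real.pi))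
    (hne : ∀ t, c' t ≠ 0) (hinj : ∀ t h, |h| ≤ Real.pi → c (t + h) = c t → h = 0)
    (L : ℝ) (hL : 1 < L) :
    ∃ δ : ℝ, 0 < δ ∧ ∃ N M : ℝ → E3, (∀ t, ‖N t‖ = 1) ∧ (∀ t, ‖M t‖ = 1) ∧
      (∀ t, inner ℝ (N t) (M t) = (0:ℝ)) ∧
      (∀ t x, inner ℝ (c' t) x = (0:ℝ) → ∃ a b : ℝ, x = a • N t + b • M t) ∧
      ∀ s t, ∀ u v : E2, ‖u‖ ≤ δ → ‖v‖ ≤ δ →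
        L⁻¹ * Real.sqrt (dist (c s) (c t) ^ 2 + dist u v ^ 2) ≤
          dist (c s + (u 0 • N s + u 1 • M s)) (c t + (v 0 • N t + v 1 • M t)) ∧
        dist (c s + (u 0 • N s + u 1 • M s)) (c t + (v 0 • N t + v 1 • M t)) ≤
          L * Real.sqrt (dist (c s) (c t) ^ 2 + dist u v ^ 2) := by
  obtain ⟨N, M, hNs, hMs, hNp, hMp, hN, hM, hNM, hcN, hcM, hspan⟩ := frame c' hc' hp' hne
  obtain ⟨K, hK0, hK⟩ := periodic_lip c' hc' hp'
  obtain ⟨KN, hKN0, hKN⟩ := periodic_lip N hNs hNp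
  obtain ⟨KM, hKM0, hKM⟩ := periodic_lip M hMs hMp
  obtain ⟨k, hk0, hk⟩ := lower_bd c c' hc hc'.continuous hp hp' hne hinj K hK0 hK
  set C : ℝ := 2 * K / k ^ 2 + (KN + KM) / k with hC
  have hC0 : 0 ≤ C := by positivity
  have hLi : L⁻¹ < 1 := inv_lt_one_of_one_lt₀ hL
  have hLi0 : 0 < L⁻¹ := by positivity
  have hLL : L * L⁻¹ = 1 := mul_inv_cancel₀ (by positivity)
  set δ : ℝ := (1 - L⁻¹) / (3 * C + 1) with hδ
  have hδ0 : 0 < δ := div_pos (by linarith) (by positivity)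
  have hδC : 3 * (C * δ) ≤ 1 - L⁻¹ := by
    have : (3 * C + 1) * δ = 1 - L⁻¹ := by rw [hδ]; field_simp
    nlinarith
  refine ⟨δ, hδ0, N, M, hN, hM, hNM, hspan, ?_⟩
  have main : ∀ s t, |s - t| ≤ Real.pi → ∀ u v : E2, ‖u‖ ≤ δ → ‖v‖ ≤ δ →
        L⁻¹ * Real.sqrt (dist (c s) (c t) ^ 2 + dist u v ^ 2) ≤
          dist (c s + (u 0 • N s + u 1 • M s)) (c t + (v 0 • N t + v 1 • M t)) ∧
        dist (c s + (u 0 • N s + u 1 • M s)) (c t + (v 0 • N t + v 1 • M t)) ≤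
          L * Real.sqrt (dist (c s) (c t) ^ 2 + dist u v ^ 2) := by
    intro s t hst u v hu hv
    have hkst := hk s t hst
    have hT := taylor_bd c c' hc K hK0 hK s t
    set X := c s - c t with hX
    set Y := (u - v) 0 • N t + (u - v) 1 • M t with hY
    set Z := u 0 • (N s - N t) + u 1 • (M s - M t) with hZ
    have hYn : ‖Y‖ = ‖u - v‖ := norm_comb _ _ (hN t) (hM t) (hNM t) _
    have hY2 : ‖Y‖ ≤ 2 * δ := by
      rw [hYn]; linarith [norm_sub_le u v]
    have hd : |s - t| ≤ ‖X‖ / k := by rw [le_div_iff₀ hk0]; linarith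
    have hXY : |inner ℝ X Y| ≤ C * δ * ‖X‖ ^ 2 := by
      have e0 : inner ℝ (c' t) Y = (0:ℝ) := by
        simp [hY, inner_add_right, inner_smul_right, hcN, hcM]
      have e1 : inner ℝ X Y = inner ℝ (X - (s - t) • c' t) Y := by
        rw [inner_sub_left X, inner_smul_left, e0]; simp
      rw [e1]
      calc _ ≤ ‖X - (s - t) • c' t‖ * ‖Y‖ := abs_real_inner_le_norm _ _
        _ ≤ (K * |s - t| ^ 2) * (2 * δ) := by gcongr
        _ ≤ (K * (‖X‖ / k) ^ 2) * (2 * δ) := by gcongr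
        _ = (2 * K / k ^ 2) * δ * ‖X‖ ^ 2 := by field_simp
        _ ≤ _ := by
          gcongr
          rw [hC]
          have : 0 ≤ (KN + KM) / k := by positivity
          linarith
    have hZn : ‖Z‖ ≤ C * δ * ‖X‖ := by
      have u0 : ‖u 0‖ ≤ δ := (PiLp.norm_apply_le u 0).trans hu
      have u1 : ‖u 1‖ ≤ δ := (PiLp.norm_apply_le u 1).trans hu
      calc ‖Z‖ ≤ ‖u 0‖ * ‖N s - N t‖ + ‖u 1‖ * ‖M s - M t‖ := by
            refine (norm_add_le _ _).trans ?_
            rw [norm_smul, norm_smul]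
        _ ≤ δ * (KN * |s - t|) + δ * (KM * |s - t|) := by
            gcongr
            · exact hKN s t
            · exact hKM s t
        _ = δ * ((KN + KM) * |s - t|) := by ring
        _ ≤ δ * ((KN + KM) * (‖X‖ / k)) := by gcongr
        _ = (KN + KM) / k * δ * ‖X‖ := by ring
        _ ≤ _ := by
          gcongr
          rw [hC]
          have : 0 ≤ 2 * K / k ^ 2 := by positivity
          linarith
    have hCd : 0 ≤ C * δ := by positivity
    obtain ⟨r1, r2⟩ := key_est X Y Z (C * δ) hCd (by linarith) hXY hZn
    have e1 : dist (c s + (u 0 • N s + u 1 • M s)) (c t + (v 0 • N t + v 1 • M t))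
        = ‖X + Y + Z‖ := by
      rw [dist_eq_norm, hX, hY, hZ]
      congr 1
      simp only [PiLp.sub_apply]
      module
    rw [e1, dist_eq_norm, dist_eq_norm u v, ← hYn, ← hX]
    have hD0 := Real.sqrt_nonneg (‖X‖ ^ 2 + ‖Y‖ ^ 2)
    refine ⟨(mul_le_mul_of_nonneg_right ?_ hD0).trans r1,
      r2.trans (mul_le_mul_of_nonneg_right ?_ hD0)⟩
    · linarith
    · nlinarith [mul_pos (sub_pos.2 hL) (sub_pos.2 hLi)]
  intro s t u v hu hv
  obtain ⟨j, hj, -⟩ := existsUnique_add_zsmul_mem_Ico Real.two_pi_pos s (t - Real.pi)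
  have := main (s + j • (2 * Real.pi)) t
    (abs_le.2 ⟨by linarith [hj.1], by linarith [hj.2]⟩) u v hu hv
  rwa [hp.zsmul j, hNp.zsmul j, hMp.zsmul j] at this

lemma tube (c c' : ℝ → E3) (hc : ∀ t, HasDerivAt c (c' t) t) (hc' : ContDiff ℝ 1 c')
    (hp : Function.Periodic c (2 * Real.pi)) (hp' : Function.Periodic c' (2 * Real.pi))
    (hne : ∀ t, c' t ≠ 0) (hinj : ∀ t h, |h| ≤ Real.pi → c (t + h) = c t → h = 0)
    (S : Set E3) (hS : S = Set.range c)
    (L : ℝ) (hL : 1 < L) :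
    ∃ δ : ℝ, 0 < δ ∧
      ∃ e : S × (Metric.closedBall (0 : E2) δ) →
            {x : E3 | Metric.infDist x S ≤ δ},
        Function.Bijective e ∧
        (∀ (p : S) (z : Metric.closedBall (0 : E2) δ),
          (z : E2) = 0 → ((e (p, z)) : E3) = (p : E3)) ∧
        (∀ (p q : S) (u v : Metric.closedBall (0 : E2) δ),
          L⁻¹ * Real.sqrt (dist (p : E3) (q : E3) ^ 2 + dist (u : E2) (v : E2) ^ 2)
            ≤ dist ((e (p, u)) : E3) ((e (q, v)) : E3) ∧
          dist ((e (p, u)) : E3) ((e (q, v)) : E3)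
            ≤ L * Real.sqrt (dist (p : E3) (q : E3) ^ 2 + dist (u : E2) (v : E2) ^ 2)) := by
  obtain ⟨δ, hδ, N, M, hN, hM, hNM, hspan, hb⟩ := core c c' hc hc' hp hp' hne hinj L hL
  have hcc : Continuous c := continuous_iff_continuousAt.2 fun t => (hc t).continuousAt
  have hθ : ∀ p : S, ∃ t, c t = p := fun p => by
    have h1 : ∀ x ∈ S, ∃ t, c t = x := by rw [hS]; exact fun x hx => hx
    exact h1 p p.2
  choose θ hθ using hθ
  have hcS : ∀ t, c t ∈ S := fun t => by rw [hS]; exact ⟨t, rfl⟩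
  have hScomp : IsCompact S := by
    rw [hS]; exact hp.compact_of_continuous Real.two_pi_pos.ne' hcc
  let F : ℝ → E2 → E3 := fun t u => c t + (u 0 • N t + u 1 • M t)
  have hF : ∀ (p : S) (u : Metric.closedBall (0 : E2) δ),
      F (θ p) u ∈ {x : E3 | Metric.infDist x S ≤ δ} := by
    intro p u
    have h1 := Metric.infDist_le_dist_of_mem (x := F (θ p) u) (hcS (θ p))
    refine h1.trans ?_
    rw [dist_eq_norm]
    simp only [F, add_sub_cancel_left]
    rw [norm_comb _ _ (hN _) (hM _) (hNM _)]
    exact mem_closedBall_zero_iff.1 u.2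
  have hbil : ∀ (p q : S) (u v : Metric.closedBall (0 : E2) δ),
      L⁻¹ * Real.sqrt (dist (p : E3) (q : E3) ^ 2 + dist (u : E2) (v : E2) ^ 2)
        ≤ dist (F (θ p) u) (F (θ q) v) ∧
      dist (F (θ p) u) (F (θ q) v)
        ≤ L * Real.sqrt (dist (p : E3) (q : E3) ^ 2 + dist (u : E2) (v : E2) ^ 2) := by
    intro p q u v
    have := hb (θ p) (θ q) u v (mem_closedBall_zero_iff.1 u.2) (mem_closedBall_zero_iff.1 v.2)
    rw [hθ, hθ] at this
    simpa only [F, hθ] using this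
  refine ⟨δ, hδ, fun x => ⟨F (θ x.1) x.2, hF x.1 x.2⟩, ⟨?_, ?_⟩, ?_, hbil⟩
  · rintro ⟨p, u⟩ ⟨q, v⟩ h
    have h' : F (θ p) u = F (θ q) v := congrArg Subtype.val h
    have h1 := (hbil p q u v).1
    rw [h', dist_self] at h1
    have h2 : Real.sqrt (dist (p : E3) (q : E3) ^ 2 + dist (u : E2) (v : E2) ^ 2) ≤ 0 := by
      have : 0 < L⁻¹ := by positivity
      nlinarith
    have h3 := Real.sqrt_eq_zero'.1 (le_antisymm h2 (Real.sqrt_nonneg _))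
    have hp0 : dist (p : E3) q = 0 := by
      nlinarith [sq_nonneg (dist (p : E3) q), sq_nonneg (dist (u : E2) v)]
    have hu0 : dist (u : E2) v = 0 := by
      nlinarith [sq_nonneg (dist (p : E3) q), sq_nonneg (dist (u : E2) v)]
    exact Prod.ext (Subtype.ext (dist_eq_zero.1 hp0)) (Subtype.ext (dist_eq_zero.1 hu0))
  · rintro ⟨x, hx⟩
    obtain ⟨p, hpS, hpx⟩ := hScomp.exists_infDist_eq_dist ⟨_, hcS 0⟩ x
    have hx' : Metric.infDist x S ≤ δ := hx
    set t := θ ⟨p, hpS⟩ with ht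
    have htp : c t = p := hθ ⟨p, hpS⟩
    have hmin : IsLocalMin (fun s => ‖x - c s‖ ^ 2) t := by
      refine Filter.Eventually.of_forall fun s => ?_
      have := Metric.infDist_le_dist_of_mem (x := x) (hcS s)
      rw [hpx, ← htp, dist_eq_norm, dist_eq_norm] at this
      exact pow_le_pow_left₀ (norm_nonneg _) this 2
    have hd : HasDerivAt (fun s => ‖x - c s‖ ^ 2) (2 * inner ℝ (x - c t) (-c' t)) t :=
      ((hc t).const_sub x).norm_sq
    have h0 := hmin.hasDerivAt_eq_zero hd
    have h1 : inner ℝ (c' t) (x - c t) = (0:ℝ) := by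
      rw [inner_neg_right, real_inner_comm] at h0; linarith
    obtain ⟨a, b, hab⟩ := hspan t _ h1
    have hn := norm_comb _ _ (hN t) (hM t) (hNM t) !₂[a, b]
    have hab' : x - c t = (!₂[a, b] : E2) 0 • N t + (!₂[a, b] : E2) 1 • M t := by
      rw [hab]; simp
    refine ⟨(⟨p, hpS⟩, ⟨!₂[a, b], ?_⟩), Subtype.ext ?_⟩
    · rw [mem_closedBall_zero_iff, ← hn, ← hab', htp, ← dist_eq_norm, ← hpx]
      exact hx'
    · simp only [F]
      rw [← ht, ← hab', add_sub_cancel]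
  · intro p z hz
    simp [F, hz, hθ]

/-- the standard parametrization of the circle -/
def circR (t : ℝ) : E2 := !₂[Real.cos t, Real.sin t]

lemma circR_mem (t : ℝ) : circR t ∈ Metric.sphere (0 : E2) 1 := by
  rw [mem_sphere_zero_iff_norm, EuclideanSpace.norm_eq]
  simp [circR]

def circ : ℝ → Metric.sphere (0 : E2) 1 := Set.codRestrict circR _ circR_mem

lemma circR_smooth : ContDiff ℝ (⊤ : ℕ∞) circR := by
  rw [contDiff_euclidean]
  intro i
  fin_cases i
  · simpa [circR] using Real.contDiff_cos
  · simpa [circR] using Real.contDiff_sin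

lemma fact_E2 : Fact (Module.finrank ℝ E2 = 1 + 1) := ⟨by simp⟩

lemma circ_smooth : ContMDiff 𝓘(ℝ, ℝ) (𝓡 1) (⊤ : ℕ∞) circ := by
  have := fact_E2
  exact ContMDiff.codRestrict_sphere circR_smooth.contMDiff circR_mem

lemma circ_surj : Function.Surjective circ := by
  rintro ⟨x, hx⟩
  rw [mem_sphere_zero_iff_norm, EuclideanSpace.norm_eq, Real.sqrt_eq_one] at hx
  simp at hx
  let z : ℂ := ⟨x 0, x 1⟩
  have hz : ‖z‖ = 1 := by
    rw [← sq_eq_sq₀ (norm_nonneg _) zero_le_one, ← Complex.normSq_eq_norm_sq, Complex.normSq_mk]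
    linarith
  have hz0 : z ≠ 0 := by intro h; simp [h] at hz
  refine ⟨z.arg, Subtype.ext ?_⟩
  change circR _ = x
  ext i
  fin_cases i
  · simp [circR, Complex.cos_arg hz0, hz, z]
  · simp [circR, Complex.sin_arg, hz, z]

lemma circ_periodic : Function.Periodic circ (2 * Real.pi) := fun t => Subtype.ext (by
  change circR _ = circR _
  simp [circR])

lemma circ_inj (t h : ℝ) (hh : |h| ≤ Real.pi) (he : circ (t + h) = circ t) : h = 0 := by
  have he' : circR (t + h) = circR t := congrArg Subtype.val he
  have h0 : Real.cos (t + h) = Real.cos t := by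
    simpa [circR] using congrArg (fun x : E2 => x 0) he'
  have h1 : Real.sin (t + h) = Real.sin t := by
    simpa [circR] using congrArg (fun x : E2 => x 1) he'
  obtain ⟨n, hn⟩ := Real.Angle.angle_eq_iff_two_pi_dvd_sub.1 (Real.Angle.cos_sin_inj h0 h1)
  rw [add_sub_cancel_left] at hn
  have hpi := Real.pi_pos
  have : |(n:ℝ)| < 1 := by
    rw [hn, abs_mul, abs_of_pos Real.two_pi_pos] at hh
    nlinarith
  have : n = 0 := by
    rw [← Int.cast_abs] at this
    exact Int.abs_lt_one_iff.1 (by exact_mod_cast this)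
  simp [hn, this]

lemma circR_deriv_ne (t : ℝ) (D : E2) (h : HasDerivAt circR D t) : D ≠ 0 := by
  have h0 := ((EuclideanSpace.proj 0 : E2 →L[ℝ] ℝ)).hasFDerivAt.comp_hasDerivAt t h
  have h1 := ((EuclideanSpace.proj 1 : E2 →L[ℝ] ℝ)).hasFDerivAt.comp_hasDerivAt t h
  have h0' : HasDerivAt Real.cos (D 0) t := h0
  have h1' : HasDerivAt Real.sin (D 1) t := h1
  have a0 := h0'.unique (Real.hasDerivAt_cos t)
  have a1 := h1'.unique (Real.hasDerivAt_sin t)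
  intro hD
  have := Real.sin_sq_add_cos_sq t
  simp [hD] at a0 a1
  simp [← a1, a0] at this

lemma coe_smooth : ContMDiff (𝓡 1) 𝓘(ℝ, E2) 1 ((↑) : Metric.sphere (0 : E2) 1 → E2) := by
  have := fact_E2
  exact contMDiff_coe_sphere

lemma comp_deriv {F : Type*} [NormedAddCommGroup F] [NormedSpace ℝ F]
    (g : Metric.sphere (0 : E2) 1 → F) (t : ℝ) (hg : MDifferentiableAt (𝓡 1) 𝓘(ℝ, F) g (circ t)) :
    HasDerivAt (g ∘ circ) (mfderiv (𝓡 1) 𝓘(ℝ, F) g (circ t)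
      (mfderiv 𝓘(ℝ, ℝ) (𝓡 1) circ t (1 : ℝ))) t := by
  have hc : MDifferentiableAt 𝓘(ℝ, ℝ) (𝓡 1) circ t := (circ_smooth.mdifferentiable (by simp)) t
  let A : EuclideanSpace ℝ (Fin 1) →L[ℝ] F := mfderiv (𝓡 1) 𝓘(ℝ, F) g (circ t)
  let B : ℝ →L[ℝ] EuclideanSpace ℝ (Fin 1) := mfderiv 𝓘(ℝ, ℝ) (𝓡 1) circ t
  have h1 : HasFDerivAt (g ∘ circ) (A.comp B) t :=
    (hg.hasMFDerivAt.comp t hc.hasMFDerivAt).hasFDerivAt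
  exact h1.hasDerivAt

lemma circ_mfderiv_ne (t : ℝ) : mfderiv 𝓘(ℝ, ℝ) (𝓡 1) circ t (1 : ℝ) ≠ 0 := by
  intro h
  have h1 := comp_deriv ((↑) : Metric.sphere (0 : E2) 1 → E2) t
    ((coe_smooth.mdifferentiable (by simp)) _)
  refine circR_deriv_ne t _ h1 ?_
  rw [h]
  exact map_zero _

/-- **Lemma 3.3 (bilipschitz tubular neighborhoods).** Let `γ` be a smooth embedding of
the unit circle `S¹ ⊆ ℝ²` into `ℝ³` (a `C^∞` injective map whose differential is
injective at every point) and let `σ = γ(S¹)` with the metric restricted from `ℝ³`.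
Then for every `L > 1` there are `δ > 0` and a bijection
`e : σ × B̄²(δ) → {x : dist(x,σ) ≤ δ}` with `e(x,0) = x` which is `L`-bilipschitz for the
`ℓ²`-product metric on `σ × B̄²(δ)`. -/
theorem bilipschitz_tubular_neighborhood
    (γ : (Metric.sphere (0 : EuclideanSpace ℝ (Fin 2)) 1) → EuclideanSpace ℝ (Fin 3))
    (hsmooth : ContMDiff (𝓡 1) 𝓘(ℝ, EuclideanSpace ℝ (Fin 3)) (⊤ : ℕ∞) γ)
    (hinj : Function.Injective γ)
    (hder : ∀ x, Function.Injective
      (mfderiv (𝓡 1) 𝓘(ℝ, EuclideanSpace ℝ (Fin 3)) γ x))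
    (L : ℝ) (hL : 1 < L) :
    ∃ δ : ℝ, 0 < δ ∧
      ∃ e : (Set.range γ) × (Metric.closedBall (0 : EuclideanSpace ℝ (Fin 2)) δ) →
            {x : EuclideanSpace ℝ (Fin 3) | Metric.infDist x (Set.range γ) ≤ δ},
        Function.Bijective e ∧
        (∀ (p : Set.range γ) (z : Metric.closedBall (0 : EuclideanSpace ℝ (Fin 2)) δ),
          (z : EuclideanSpace ℝ (Fin 2)) = 0 →
            ((e (p, z)) : EuclideanSpace ℝ (Fin 3)) = (p : EuclideanSpace ℝ (Fin 3))) ∧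
        (∀ (p q : Set.range γ)
           (u v : Metric.closedBall (0 : EuclideanSpace ℝ (Fin 2)) δ),
          L⁻¹ * Real.sqrt
              (dist (p : EuclideanSpace ℝ (Fin 3)) (q : EuclideanSpace ℝ (Fin 3)) ^ 2 +
                dist (u : EuclideanSpace ℝ (Fin 2)) (v : EuclideanSpace ℝ (Fin 2)) ^ 2)
            ≤ dist ((e (p, u)) : EuclideanSpace ℝ (Fin 3))
                ((e (q, v)) : EuclideanSpace ℝ (Fin 3)) ∧
          dist ((e (p, u)) : EuclideanSpace ℝ (Fin 3))
              ((e (q, v)) : EuclideanSpace ℝ (Fin 3))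
            ≤ L * Real.sqrt
                (dist (p : EuclideanSpace ℝ (Fin 3)) (q : EuclideanSpace ℝ (Fin 3)) ^ 2 +
                  dist (u : EuclideanSpace ℝ (Fin 2)) (v : EuclideanSpace ℝ (Fin 2)) ^ 2)) := by
  have hdiff : MDifferentiable (𝓡 1) 𝓘(ℝ, E3) γ := hsmooth.mdifferentiable (by simp)
  have hs : ContDiff ℝ (⊤ : ℕ∞) (γ ∘ circ) := (hsmooth.comp circ_smooth).contDiff
  have hp : Function.Periodic (γ ∘ circ) (2 * Real.pi) := fun t => by
    simp only [Function.comp_apply, circ_periodic t]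
  have hp' : Function.Periodic (deriv (γ ∘ circ)) (2 * Real.pi) := by
    intro t
    rw [← deriv_comp_add_const]
    congr 1
    funext x
    exact hp x
  refine tube (γ ∘ circ) (deriv (γ ∘ circ))
    (fun t => (hs.differentiable (by simp) t).hasDerivAt) ?_ hp hp' ?_ ?_ _ ?_ L hL
  · have h2 : ContDiff ℝ (1 + 1) (γ ∘ circ) := by
      have h3 := contDiff_infty.1 hs 2
      rw [one_add_one_eq_two]; exact h3
    exact (contDiff_succ_iff_deriv.1 h2).2.2
  · intro t h0
    have h1 := comp_deriv γ t (hdiff _)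
    rw [h1.deriv] at h0
    exact circ_mfderiv_ne t (hder (circ t) (h0.trans (map_zero _).symm))
  · intro t h hh he
    exact circ_inj t h hh (hinj he)
  · exact (circ_surj.range_comp γ).symm

end
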